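/- arXiv:q-alg/9701013 — 2 statements merged into one kernel-verified Lean document; each statement's English description precedes it below -/
import Mathlib

section
/- Let d ≥ 1, let t : Equiv.Perm (Fin (2*d)) be a fixed-point-free involution (t ∘ t = id and t i ≠ i for all i), and let s : Equiv.Perm (Fin (2*d)) be the cyclic shift i ↦ i + 1. Then the number of orbits (cycles, counting fixed points) of the permutation s * t (apply t first, then s) acting on Fin (2*d) is at most d + 1; moreover this number equals d + 1 if and only if the chord diagram determined by t is noncrossing, i.e. there exist no i, j : Fin (2*d) with i < j, j < t i and t i < t j in the natural linear order of Fin (2*d). -/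
/-- The number of orbits (cycles, counting fixed points) of a permutation `σ` of `α`,
i.e. the number of orbits of the cyclic subgroup generated by `σ` acting on `α`. -/
noncomputable def permOrbits {α : Type*} (σ : Equiv.Perm α) : ℕ :=
  Nat.card (MulAction.orbitRel.Quotient (Subgroup.zpowers σ) α)

open Equiv Equiv.Perm

/-- functions invariant under `σ` -/
def FixS {α : Type*} (σ : Equiv.Perm α) : Submodule ℚ (α → ℚ) where
  carrier := {f | ∀ x, f (σ x) = f x}
  add_mem' := by intro f g hf hg x; simp [hf x, hg x]
  zero_mem' := by intro x; rfl
  smul_mem' := by intro c f hf x; simp [hf x]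

/-- functions agreeing at `a`, `b` -/
def HypS {α : Type*} (a b : α) : Submodule ℚ (α → ℚ) where
  carrier := {f | f a = f b}
  add_mem' := by
    intro f g hf hg
    simp only [Set.mem_ofPred_eq, Pi.add_apply] at *
    rw [hf, hg]
  zero_mem' := by simp
  smul_mem' := by
    intro c f hf
    simp only [Set.mem_ofPred_eq, Pi.smul_apply] at *
    rw [hf]

lemma fix_zpow {α : Type*} {σ : Equiv.Perm α} {f : α → ℚ} (hf : f ∈ FixS σ) (n : ℤ) (x : α) :
    f ((σ ^ n) x) = f x := by
  have hf' : ∀ x, f (σ x) = f x := hf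
  induction n using Int.induction_on generalizing x with
  | zero => simp
  | succ i ih => rw [zpow_add_one, Perm.mul_apply, ih, hf']
  | pred i ih =>
    rw [zpow_sub_one, Perm.mul_apply, ih, ← hf' (σ⁻¹ x)]
    simp

lemma fix_sc {α : Type*} {σ : Equiv.Perm α} {f : α → ℚ} (hf : f ∈ FixS σ) {x y : α}
    (h : SameCycle σ x y) : f x = f y := by
  obtain ⟨n, rfl⟩ := h
  rw [fix_zpow hf]

lemma rel_iff {α : Type*} (σ : Equiv.Perm α) (x y : α) :
    (MulAction.orbitRel (Subgroup.zpowers σ) α) x y ↔ SameCycle σ y x := by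
  rw [MulAction.orbitRel_apply, MulAction.mem_orbit_iff]
  constructor
  · rintro ⟨⟨g, n, rfl⟩, h⟩
    exact ⟨n, h⟩
  · rintro ⟨n, h⟩
    exact ⟨⟨σ ^ n, n, rfl⟩, h⟩

/-- invariant functions are functions on the quotient -/
noncomputable def fixEquiv {α : Type*} (σ : Equiv.Perm α) :
    (MulAction.orbitRel.Quotient (Subgroup.zpowers σ) α → ℚ) ≃ₗ[ℚ] FixS σ where
  toFun g := ⟨fun x => g (Quotient.mk _ x), fun x => by
    have : (Quotient.mk (MulAction.orbitRel (Subgroup.zpowers σ) α) (σ x)) =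
      Quotient.mk (MulAction.orbitRel (Subgroup.zpowers σ) α) x :=
      Quotient.sound ((rel_iff σ _ _).2 ⟨1, by simp⟩)
    exact congrArg g this⟩
  map_add' g h := rfl
  map_smul' c g := rfl
  invFun f := fun q => Quotient.lift f.1 (fun x y h => (fix_sc f.2 ((rel_iff σ _ _).1 h)).symm) q
  left_inv g := by
    funext q
    induction q using Quotient.inductionOn
    rfl
  right_inv f := rfl

lemma permOrbits_eq {α : Type*} [Finite α] (σ : Equiv.Perm α) :
    permOrbits σ = Module.finrank ℚ (FixS σ) := by
  classical
  have : Finite (MulAction.orbitRel.Quotient (Subgroup.zpowers σ) α) := Quotient.finite _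
  have := Fintype.ofFinite (MulAction.orbitRel.Quotient (Subgroup.zpowers σ) α)
  rw [← (fixEquiv σ).finrank_eq, Module.finrank_fintype_fun_eq_card, permOrbits,
    Nat.card_eq_fintype_card]

section
variable {α : Type*} [Finite α] [DecidableEq α]

lemma fix_inf (σ : Equiv.Perm α) (a b : α) :
    FixS (σ * swap a b) ⊓ HypS a b = FixS σ ⊓ HypS a b := by
  have key : ∀ σ : Equiv.Perm α, FixS σ ⊓ HypS a b ≤ FixS (σ * swap a b) ⊓ HypS a b := by
    rintro σ f ⟨hf, hab⟩
    refine ⟨fun x => ?_, hab⟩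
    have hf' : ∀ x, f (σ x) = f x := hf
    have hab' : f a = f b := hab
    rw [Perm.mul_apply, hf']
    by_cases h1 : x = a
    · subst h1; simp [hab']
    by_cases h2 : x = b
    · subst h2; simp [hab']
    rw [swap_apply_of_ne_of_ne h1 h2]
  refine le_antisymm ?_ (key σ)
  have := key (σ * swap a b)
  rwa [mul_assoc, swap_mul_self, mul_one] at this

lemma orbrank_le (σ : Equiv.Perm α) (a b : α) :
    permOrbits σ ≤ Module.finrank ℚ ↥(FixS σ ⊓ HypS a b) + 1 := by
  classical
  have := Fintype.ofFinite α
  rw [permOrbits_eq]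
  let φ : FixS σ →ₗ[ℚ] ℚ :=
    ((LinearMap.proj a : (α → ℚ) →ₗ[ℚ] ℚ) - LinearMap.proj b).comp (FixS σ).subtype
  have h1 := LinearMap.finrank_range_add_finrank_ker φ
  have h2 : Module.finrank ℚ (LinearMap.range φ) ≤ 1 := by
    simpa using Submodule.finrank_le (LinearMap.range φ)
  have h3 : Module.finrank ℚ (LinearMap.ker φ) ≤ Module.finrank ℚ ↥(FixS σ ⊓ HypS a b) := by
    rw [← Submodule.finrank_map_subtype_eq]
    apply Submodule.finrank_mono
    rintro f ⟨⟨g, hg⟩, hk, rfl⟩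
    refine ⟨hg, ?_⟩
    have : g a - g b = 0 := hk
    exact sub_eq_zero.1 this
  omega

lemma le_rank_sc (σ : Equiv.Perm α) (a b : α) (h : SameCycle σ a b) :
    permOrbits σ ≤ Module.finrank ℚ ↥(FixS σ ⊓ HypS a b) := by
  rw [permOrbits_eq]
  have := Fintype.ofFinite α
  exact Submodule.finrank_mono (le_inf le_rfl (fun f hf => fix_sc hf h))

lemma orbrank_le' (σ : Equiv.Perm α) (a b : α) :
    Module.finrank ℚ ↥(FixS σ ⊓ HypS a b) ≤ permOrbits σ := by
  rw [permOrbits_eq]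
  have := Fintype.ofFinite α
  exact Submodule.finrank_mono inf_le_left

lemma rank_lt (σ : Equiv.Perm α) (a b : α) (h : ¬ SameCycle σ a b) :
    Module.finrank ℚ ↥(FixS σ ⊓ HypS a b) < permOrbits σ := by
  classical
  rw [permOrbits_eq]
  have := Fintype.ofFinite α
  apply Submodule.finrank_lt_finrank_of_lt
  refine lt_of_le_of_ne inf_le_left fun he => ?_
  have hf : (fun x => if SameCycle σ a x then (1 : ℚ) else 0) ∈ FixS σ := by
    intro x
    simp
  rw [← he] at hf
  have h2 : (if SameCycle σ a a then (1 : ℚ) else 0) = if SameCycle σ a b then (1 : ℚ) else 0 :=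
    hf.2
  simp [h, SameCycle.refl] at h2

lemma orb1 (σ : Equiv.Perm α) (a b : α) : permOrbits (σ * swap a b) ≤ permOrbits σ + 1 := by
  have h1 := orbrank_le (σ * swap a b) a b
  have h2 := orbrank_le' σ a b
  rw [fix_inf] at h1
  omega

lemma orb2 (σ : Equiv.Perm α) (a b : α) (h : ¬ SameCycle σ a b) :
    permOrbits (σ * swap a b) ≤ permOrbits σ := by
  have h1 := orbrank_le (σ * swap a b) a b
  have h2 := rank_lt σ a b h
  rw [fix_inf] at h1
  omega

lemma orb3 (σ : Equiv.Perm α) (a b : α) (h : SameCycle σ a b)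
    (h' : ¬ SameCycle (σ * swap a b) a b) :
    permOrbits σ + 1 ≤ permOrbits (σ * swap a b) := by
  have h1 := rank_lt (σ * swap a b) a b h'
  have h2 := le_rank_sc σ a b h
  rw [fix_inf] at h1
  omega

end

/-- crossing -/
def Crs {n : ℕ} (t : Perm (Fin n)) : Prop := ∃ i j, i < j ∧ j < t i ∧ t i < t j

lemma rot_val {m : ℕ} (x y : Fin (m + 1)) (h : x < y) : (finRotate (m + 1) x).val = x.val + 1 := by
  apply coe_finRotate_of_ne_last
  intro hx
  subst hx
  exact absurd (Fin.le_last y) (not_le.2 h)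

lemma chain {m : ℕ} (t : Perm (Fin (m + 1))) (k : ℕ) : ∀ (a b : Fin (m + 1)), a.val + k = b.val →
    (∀ x, a ≤ x → x < b → t x = x) → SameCycle (finRotate (m + 1) * t) a b := by
  induction k with
  | zero =>
    intro a b h _
    have : a = b := Fin.ext (by simpa using h)
    subst this
    exact SameCycle.refl _ _
  | succ k ih =>
    intro a b h hx
    have hab : a < b := by rw [Fin.lt_def]; omega
    have h1 : (finRotate (m + 1) * t) a = finRotate (m + 1) a := by
      rw [Perm.mul_apply, hx a le_rfl hab]
    have hv := rot_val a b hab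
    have h2 : SameCycle (finRotate (m + 1) * t) (finRotate (m + 1) a) b := by
      apply ih
      · omega
      · intro x hx1 hx2
        apply hx x _ hx2
        rw [Fin.le_def] at *
        omega
    rw [← h1] at h2
    exact sameCycle_apply_left.1 h2

lemma pred_inv_pow {α : Type*} (σ : Perm α) (I : α → Prop) (h : ∀ x, I x → I (σ x)) (k : ℕ) (x : α)
    (hx : I x) : I ((σ ^ k) x) := by
  induction k with
  | zero => simpa
  | succ k ih => rw [pow_succ', Perm.mul_apply]; exact h _ ih

lemma inv_sc {α : Type*} [Finite α] (σ : Perm α) (I : α → Prop) (h : ∀ x, I x → I (σ x)) {x y : α}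
    (hs : SameCycle σ x y) (hx : I x) : I y := by
  obtain ⟨k, rfl⟩ := hs.exists_nat_pow_eq
  exact pred_inv_pow σ I h k x hx

lemma inv_arc {m : ℕ} (t : Perm (Fin (m + 1))) (hinv : ∀ x, t (t x) = x) (hc : ¬ Crs t)
    (c : Fin (m + 1)) (hct : c < t c) (x : Fin (m + 1)) (hx : c < x ∧ x ≤ t c) :
    c < (finRotate (m + 1) * t) x ∧ (finRotate (m + 1) * t) x ≤ t c := by
  have key : c ≤ t x ∧ t x < t c := by
    by_cases h1 : x = t c
    · subst h1; rw [hinv]; exact ⟨le_rfl, hct⟩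
    · have hlt : x < t c := lt_of_le_of_ne hx.2 h1
      constructor
      · by_contra h2
        push Not at h2
        exact hc ⟨t x, c, h2, by rw [hinv]; exact hx.1, by rw [hinv]; exact hlt⟩
      · by_contra h2
        push Not at h2
        rcases h2.lt_or_eq with h3 | h3
        · exact hc ⟨c, x, hx.1, hlt, h3⟩
        · exact absurd (t.injective h3) (ne_of_lt hx.1)
  have hv := rot_val (t x) (t c) key.2
  rw [Perm.mul_apply]
  simp only [Fin.lt_def, Fin.le_def] at *
  omega

lemma not_sc {m : ℕ} (t : Perm (Fin (m + 1))) (hinv : ∀ x, t (t x) = x) (hc : ¬ Crs t)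
    (c : Fin (m + 1)) (hct : c < t c) (x y : Fin (m + 1)) (hx : c < x ∧ x ≤ t c)
    (hy : ¬ (c < y ∧ y ≤ t c)) : ¬ SameCycle (finRotate (m + 1) * t) x y := fun h =>
  hy (inv_sc _ (fun x => c < x ∧ x ≤ t c) (inv_arc t hinv hc c hct) h hx)

lemma rm_apply {n : ℕ} (t : Perm (Fin n)) (hinv : ∀ x, t (t x) = x) (a x : Fin n) :
    (t * swap a (t a)) x = if x = a ∨ x = t a then x else t x := by
  rw [Perm.mul_apply]
  by_cases h1 : x = a
  · subst h1; simp [hinv]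
  by_cases h2 : x = t a
  · subst h2; simp
  rw [swap_apply_of_ne_of_ne h1 h2]
  simp [h1, h2]

lemma main_aux {m : ℕ} (k : ℕ) : ∀ t : Perm (Fin (m + 1)), (∀ x, t (t x) = x) →
    t.support.card = 2 * k →
    (permOrbits (finRotate (m + 1) * t) ≤ k + 1 ∧
      (Crs t → permOrbits (finRotate (m + 1) * t) ≤ k) ∧
      (¬ Crs t → k + 1 ≤ permOrbits (finRotate (m + 1) * t))) := by
  induction k with
  | zero =>
    intro t hinv hs
    have ht : t = 1 := by simpa using hs
    have hN : permOrbits (finRotate (m + 1) * t) = 1 := by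
      rw [permOrbits, Nat.card_eq_one_iff_unique]
      refine ⟨⟨fun p q => ?_⟩, ⟨Quotient.mk _ 0⟩⟩
      induction p using Quotient.inductionOn with | _ p
      induction q using Quotient.inductionOn with | _ q
      have h0 : ∀ x, SameCycle (finRotate (m + 1) * t) 0 x := fun x =>
        chain t x.val 0 x (by simp) (by simp [ht])
      exact Quotient.sound ((rel_iff _ _ _).2 ((h0 q).symm.trans (h0 p)))
    refine ⟨hN.le, ?_, fun _ => hN.ge⟩
    rintro ⟨i, j, h1, h2, h3⟩
    subst ht
    exact absurd h1 (not_lt.2 h2.le)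
  | succ k ih =>
    intro t hinv hs
    have step : ∀ a, t a ≠ a → (∀ x, (t * swap a (t a)) ((t * swap a (t a)) x) = x) ∧
        (t * swap a (t a)).support.card = 2 * k := by
      intro a ha
      constructor
      · intro x
        rw [rm_apply t hinv, rm_apply t hinv]
        have := hinv x
        have := hinv a
        split_ifs <;> grind
      · have : (t * swap a (t a)).support = (t.support.erase a).erase (t a) := by
          ext x
          rw [mem_support, rm_apply t hinv]
          simp only [Finset.mem_erase, mem_support]
          grind
        rw [this, Finset.card_erase_of_mem, Finset.card_erase_of_mem, hs]
        · omega
        · simpa using ha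
        · simp only [Finset.mem_erase, mem_support, hinv]
          exact ⟨ha, ha.symm⟩
    have back : ∀ a, finRotate (m + 1) * t =
        (finRotate (m + 1) * (t * swap a (t a))) * swap a (t a) := by
      intro a
      rw [mul_assoc, mul_assoc, swap_mul_self, mul_one]
    have crs : ∀ a, Crs (t * swap a (t a)) → Crs t := by
      rintro a ⟨i, j, h1, h2, h3⟩
      rw [rm_apply t hinv] at h2 h3
      rw [rm_apply t hinv] at h3
      refine ⟨i, j, ?_⟩
      grind
    have hne : ∃ a, t a ≠ a := by
      have : t.support.Nonempty := by
        rw [← Finset.card_pos]; omega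
      obtain ⟨a, ha⟩ := this
      exact ⟨a, mem_support.1 ha⟩
    obtain ⟨a, ha⟩ := hne
    refine ⟨?_, ?_, ?_⟩
    · obtain ⟨h1, h2⟩ := step a ha
      have := (ih _ h1 h2).1
      rw [back a]
      have := orb1 (finRotate (m + 1) * (t * swap a (t a))) a (t a)
      omega
    · rintro ⟨i, j, hij, hji, hti⟩
      obtain ⟨h1, h2⟩ := step i (by grind)
      obtain ⟨h3, h4, h5⟩ := ih _ h1 h2
      rw [back i]
      by_cases hc : Crs (t * swap i (t i))
      · have := orb1 (finRotate (m + 1) * (t * swap i (t i))) i (t i)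
        have := h4 hc
        omega
      · have hj : (t * swap i (t i)) j = t j := by
          rw [rm_apply t hinv, if_neg]
          grind
        have hn := not_sc _ h1 hc j (by rw [hj]; exact hji.trans hti) (t i) i
          (by rw [hj]; exact ⟨hji, hti.le⟩) (fun h => absurd h.1 (not_lt.2 hij.le))
        have := orb2 _ i (t i) (fun h => hn h.symm)
        omega
    · intro hc
      have hex : (Finset.univ.filter (fun a => a < t a)).Nonempty := by
        rcases lt_or_gt_of_ne ha with h | h
        · exact ⟨t a, by simp [hinv, h]⟩
        · exact ⟨a, by simpa using h⟩
      obtain ⟨c, hc1, hc2⟩ := Finset.exists_min_image _ (fun a => (t a).val - a.val) hex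
      simp only [Finset.mem_filter, Finset.mem_univ, true_and] at hc1 hc2
      obtain ⟨h1, h2⟩ := step c hc1.ne'
      obtain ⟨h3, h4, h5⟩ := ih _ h1 h2
      have h6 := h5 (fun h => hc (crs c h))
      have hsc : SameCycle (finRotate (m + 1) * (t * swap c (t c))) c (t c) := by
        apply chain _ ((t c).val - c.val)
        · rw [Fin.lt_def] at hc1; omega
        · intro x hx1 hx2
          rw [rm_apply t hinv]
          split_ifs with h
          · rfl
          push Not at h
          have hcx : c < x := lt_of_le_of_ne hx1 h.1.symm
          by_contra hne
          have hxx := hinv x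
          rcases lt_or_gt_of_ne hne with h | h
          · have h7 := hc2 (t x) (by rw [hxx]; exact h)
            rw [hxx] at h7
            apply hc
            refine ⟨t x, c, ?_, by rw [hxx]; exact hcx, by rw [hxx]; exact hx2⟩
            simp only [Fin.lt_def] at *
            omega
          · have h7 := hc2 x h
            apply hc
            refine ⟨c, x, hcx, hx2, ?_⟩
            simp only [Fin.lt_def] at *
            omega
      have hns : ¬ SameCycle (finRotate (m + 1) * t) c (t c) := fun h =>
        not_sc t hinv hc c hc1 (t c) c ⟨hc1, le_rfl⟩ (fun h => absurd h.1 (lt_irrefl _)) h.symm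
      have h8 := orb3 _ c (t c) hsc (by rw [← back c]; exact hns)
      rw [← back c] at h8
      omega

/-- Lemma 4.1 (main case): for a chord diagram with `d` chords, modeled as a
fixed-point-free involution `t` of `Fin (2*d)`, the number of circles obtained by
doubling every chord, i.e. the number of orbits of `s * t` where `s` is the cyclic
shift `i ↦ i + 1`, is at most `d + 1`, with equality iff the diagram is noncrossing. -/
theorem stmt0 (d : ℕ) (hd : 1 ≤ d) (t : Equiv.Perm (Fin (2 * d)))
    (ht_inv : t * t = 1) (ht_fpf : ∀ i, t i ≠ i) :
    permOrbits (finRotate (2 * d) * t) ≤ d + 1 ∧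
      (permOrbits (finRotate (2 * d) * t) = d + 1 ↔
        ¬ ∃ i j : Fin (2 * d), i < j ∧ j < t i ∧ t i < t j) := by
  have hinv : ∀ x, t (t x) = x := fun x => by
    rw [← Equiv.Perm.mul_apply, ht_inv]; rfl
  have hs : t.support.card = 2 * d := by
    have : t.support = Finset.univ := by
      ext x; simp [ht_fpf x]
    rw [this]; simp
  change _ ∧ (_ ↔ ¬ Crs t)
  have gen : ∀ n (hn : 0 < n) (t : Equiv.Perm (Fin n)), (∀ x, t (t x) = x) →
      t.support.card = 2 * d → (permOrbits (finRotate n * t) ≤ d + 1 ∧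
      (Crs t → permOrbits (finRotate n * t) ≤ d) ∧
      (¬ Crs t → d + 1 ≤ permOrbits (finRotate n * t))) := by
    intro n hn
    obtain ⟨m, rfl⟩ : ∃ m, n = m + 1 := ⟨n - 1, by omega⟩
    exact main_aux d
  obtain ⟨h1, h2, h3⟩ := gen (2 * d) (by omega) t hinv hs
  refine ⟨h1, fun h hc => ?_, fun hc => le_antisymm h1 (h3 hc)⟩
  have := h2 hc
  omega
end

section
/- Let α be a nonempty finite type, let s : Equiv.Perm α be a cyclic permutation consisting of a single cycle through all elements of α, and let π : Equiv.Perm α be a product of k transpositions whose supports are pairwise disjoint. Then the number of orbits (cycles, counting fixed points) of the permutation s * π acting on α is at most k + 1. -/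
theorem inv_of_zpowers {α β : Type*} (σ : Equiv.Perm α) (g : α → β)
    (h : ∀ x, g (σ x) = g x) (τ : Equiv.Perm α) (hτ : τ ∈ Subgroup.zpowers σ) (x : α) :
    g (τ x) = g x := by
  let H : Subgroup (Equiv.Perm α) :=
    { carrier := {τ | ∀ x, g (τ x) = g x}
      one_mem' := fun x => rfl
      mul_mem' := fun {a b} ha hb x => by
        rw [Equiv.Perm.mul_apply, ha, hb]
      inv_mem' := fun {a} ha x => by
        have := ha (a⁻¹ x)
        rw [← Equiv.Perm.mul_apply, mul_inv_cancel, Equiv.Perm.one_apply] at this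
        exact this.symm }
  have : Subgroup.zpowers σ ≤ H := Subgroup.zpowers_le.2 h
  exact this hτ x

theorem permOrbits_mul_swap {α : Type*} [Fintype α] [DecidableEq α]
    (σ : Equiv.Perm α) (a b : α) :
    permOrbits (σ * Equiv.swap a b) ≤ permOrbits σ + 1 := by
  classical
  set σ' := σ * Equiv.swap a b with hσ'
  let Q := MulAction.orbitRel.Quotient (Subgroup.zpowers σ) α
  let Q' := MulAction.orbitRel.Quotient (Subgroup.zpowers σ') α
  let m : α → Q' := fun x => Quotient.mk _ x
  have hm : ∀ x, m (σ' x) = m x := fun x => Quotient.sound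
    (MulAction.orbitRel_apply.2 ⟨⟨σ', Subgroup.mem_zpowers σ'⟩, rfl⟩)
  let g : α → Q' := fun x => if m x = m b then m a else m x
  have hg : ∀ x, g (σ x) = g x := by
    intro x
    have h1 : σ x = σ' (Equiv.swap a b x) := by simp [hσ']
    have h2 : m (σ x) = m (Equiv.swap a b x) := by rw [h1, hm]
    simp only [g, h2]
    rcases eq_or_ne x a with rfl | ha
    · simp
    rcases eq_or_ne x b with rfl | hb
    · simp
    rw [Equiv.swap_apply_of_ne_of_ne ha hb]
  let G : Q → Q' := Quotient.lift g (by
    rintro x y h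
    obtain ⟨⟨τ, hτ⟩, rfl⟩ := MulAction.orbitRel_apply.1 h
    exact inv_of_zpowers σ g hg τ hτ y)
  let F : Option Q → Q' := fun o => o.elim (m b) G
  have hF : Function.Surjective F := by
    intro q
    induction q using Quotient.inductionOn with
    | h x =>
      by_cases hx : m x = m b
      · exact ⟨none, hx.symm⟩
      · exact ⟨some (Quotient.mk _ x), if_neg hx⟩
  have : Finite Q := Quotient.finite _
  have h := Nat.card_le_card_of_surjective F hF
  rw [Finite.card_option] at h
  exact h

theorem permOrbits_mul_list {α : Type*} [Fintype α] [DecidableEq α]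
    (l : List (Equiv.Perm α)) (hswap : ∀ f ∈ l, f.IsSwap) (s : Equiv.Perm α) :
    permOrbits (s * l.prod) ≤ permOrbits s + l.length := by
  induction l generalizing s with
  | nil => simp
  | cons f l ih =>
    obtain ⟨a, b, -, rfl⟩ := hswap f (by simp)
    have h1 := ih (fun f hf => hswap f (by simp [hf])) (s * Equiv.swap a b)
    have h2 := permOrbits_mul_swap s a b
    rw [List.prod_cons, ← mul_assoc, List.length_cons]
    omega

/-- Lemma 4.1 (general inequality): if `s` is a permutation of a nonempty finite type `α`
consisting of a single cycle through all elements of `α`, and `π` is a product of `k`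
transpositions with pairwise disjoint supports, then the number of orbits (cycles,
counting fixed points) of `s * π` is at most `k + 1`. -/
theorem stmt1 {α : Type*} [Fintype α] [DecidableEq α] [Nonempty α]
    (s : Equiv.Perm α) (hs : ∀ x y : α, ∃ n : ℕ, (s ^ n) x = y)
    (k : ℕ) (l : List (Equiv.Perm α)) (hlen : l.length = k)
    (hswap : ∀ f ∈ l, f.IsSwap) (hdisj : l.Pairwise Equiv.Perm.Disjoint)
    (π : Equiv.Perm α) (hπ : π = l.prod) :
    permOrbits (s * π) ≤ k + 1 := by
  have h := permOrbits_mul_list l hswap s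
  have h1 : permOrbits s ≤ 1 := by
    unfold permOrbits
    rw [Finite.card_le_one_iff_subsingleton]
    refine ⟨fun p q => ?_⟩
    induction p using Quotient.inductionOn with
    | h x =>
    induction q using Quotient.inductionOn with
    | h y =>
    obtain ⟨n, hn⟩ := hs y x
    exact Quotient.sound (MulAction.orbitRel_apply.2
      ⟨⟨s ^ n, Subgroup.npow_mem_zpowers s n⟩, hn⟩)
  subst hπ
  omega
end
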